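/- arXiv:2109.14645 — 4 statements merged into one kernel-verified Lean document; each statement's English description precedes it below -/
import Mathlib

section
/- Let n ≥ 1 and let M be an invertible real (2n)×(2n) matrix whose symplectic Gram matrix is in standard form, A = M J Mᵀ = J₂ ⊗ D with D a positive diagonal integer n×n matrix. Let N_□ := I₂ ⊗ diag(√D_{11}, …, √D_{nn}). Then there exists a symplectic matrix R (Rᵀ J R = J) such that M = N_□ Rᵀ; in particular the GKP code generated by M is symplectically equivalent to one whose stabilizer generators each act on a single quadrature. -/
open Matrix Kronecker

/-- The 2×2 symplectic form `J₂ = [[0,1],[−1,0]]`. -/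
def J2 : Matrix (Fin 2) (Fin 2) ℝ := !![0, 1; -1, 0]

/-- The symplectic form `J = J₂ ⊗ Iₙ` on `ℝ^{2n}` (indexed by `Fin 2 × Fin n`). -/
def Jn (n : ℕ) : Matrix (Fin 2 × Fin n) (Fin 2 × Fin n) ℝ :=
  J2 ⊗ₖ (1 : Matrix (Fin n) (Fin n) ℝ)

/-- If the symplectic Gram matrix of an invertible `M` is in standard form
`J₂ ⊗ D` with `D` a positive diagonal integer matrix, then with
`N_□ = I₂ ⊗ diag(√D₁₁, …, √Dₙₙ)` there is a symplectic `R` such that `M = N_□ Rᵀ`. -/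
theorem stmt2 (n : ℕ) (hn : 1 ≤ n)
    (M : Matrix (Fin 2 × Fin n) (Fin 2 × Fin n) ℝ) (hM : IsUnit M.det)
    (D : Matrix (Fin n) (Fin n) ℝ)
    (hDdiag : D.IsDiag) (hDpos : ∀ j, 0 < D j j)
    (hDint : ∀ i j, ∃ z : ℤ, D i j = (z : ℝ))
    (hA : M * Jn n * Mᵀ = J2 ⊗ₖ D) :
    ∃ R : Matrix (Fin 2 × Fin n) (Fin 2 × Fin n) ℝ,
      Rᵀ * Jn n * R = Jn n ∧
      M = ((1 : Matrix (Fin 2) (Fin 2) ℝ) ⊗ₖ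
            Matrix.diagonal (fun j => Real.sqrt (D j j))) * Rᵀ := by
  have hs (j : Fin n) : Real.sqrt (D j j) ≠ 0 := (Real.sqrt_pos.2 (hDpos j)).ne'
  set N : Matrix (Fin n) (Fin n) ℝ := Matrix.diagonal fun j => Real.sqrt (D j j)
  set P : Matrix (Fin n) (Fin n) ℝ := Matrix.diagonal fun j => (Real.sqrt (D j j))⁻¹
  have hNP : N * P = 1 := by
    simp [N, P, hs]
  have hPDP : P * D * P = 1 := by
    rw [← hDdiag.diagonal_diag, Matrix.diagonal_mul_diagonal, Matrix.diagonal_mul_diagonal,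
      ← Matrix.diagonal_one]
    congr 1
    funext j
    rw [Matrix.diag_apply, inv_mul_eq_div, Real.div_sqrt, mul_inv_cancel₀ (hs j)]
  refine ⟨((1 ⊗ₖ P) * M)ᵀ, ?_, ?_⟩
  · calc ((1 ⊗ₖ P) * M)ᵀᵀ * Jn n * ((1 ⊗ₖ P) * M)ᵀ
        = (1 ⊗ₖ P) * (M * Jn n * Mᵀ) * (1 ⊗ₖ P)ᵀ := by
          simp only [Matrix.transpose_transpose, Matrix.transpose_mul, Matrix.mul_assoc]
      _ = J2 ⊗ₖ (P * D * P) := by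
          rw [hA, ← Matrix.kroneckerMap_transpose, Matrix.transpose_one,
            Matrix.diagonal_transpose, ← Matrix.mul_kronecker_mul, ← Matrix.mul_kronecker_mul,
            Matrix.one_mul, Matrix.mul_one]
      _ = Jn n := by rw [hPDP, Jn]
  · rw [Matrix.transpose_transpose, ← Matrix.mul_assoc, ← Matrix.mul_kronecker_mul, hNP,
      Matrix.one_mul, Matrix.one_kronecker_one, Matrix.one_mul]
end

section
/- Let n ≥ 1 and let M be an invertible real (2n)×(2n) matrix whose symplectic Gram matrix is in standard form, A = M J Mᵀ = J₂ ⊗ D with D a positive diagonal integer n×n matrix with non-increasing diagonal entries. If d := |det M| = ∏_{j=1}^n D_{jj} is a prime number, then D = diag(d, 1, …, 1), and there exists a symplectic matrix R (Rᵀ J R = J) such that M = N' Rᵀ where N' = I₂ ⊗ diag(√d, 1, …, 1). -/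
open Matrix Kronecker

/-- An antitone tuple of natural numbers with prime product `p` is `(p, 1, …, 1)`. -/
theorem Nat.Prime.eq_ite_of_antitone_of_prod_eq {n p : ℕ} (hp : p.Prime) {f : Fin n → ℕ}
    (hf : Antitone f) (hprod : ∏ j, f j = p) (j : Fin n) :
    f j = if (j : ℕ) = 0 then p else 1 := by
  obtain ⟨k, -, hk⟩ := (hp.prime.dvd_finsetProd_iff f).1 hprod.symm.dvd
  have hdvd (i : Fin n) : f i ∣ p := hprod ▸ Finset.dvd_prod_of_mem f (Finset.mem_univ i)
  let z : Fin n := ⟨0, j.pos⟩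
  have hz : f z = p := by
    refine le_antisymm (Nat.le_of_dvd hp.pos (hdvd z)) ?_
    rw [Nat.dvd_antisymm hk (hdvd k)]
    exact hf (Fin.mk_le_of_le_val (Nat.zero_le _))
  split_ifs with hj
  · rwa [show j = z from Fin.ext hj]
  · rw [← Finset.mul_prod_erase Finset.univ f (Finset.mem_univ z), hz] at hprod
    have hrest := (Nat.mul_eq_left hp.ne_zero).1 hprod
    refine Nat.dvd_one.1 (hrest ▸ Finset.dvd_prod_of_mem f (Finset.mem_erase.2 ⟨?_, ?_⟩))
    · exact fun h => hj (congrArg Fin.val h)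
    · exact Finset.mem_univ j

theorem det_J2 : J2.det = 1 := by
  simp [J2]

theorem abs_det_eq_abs_det_of_gram_eq {n : ℕ} {M : Matrix (Fin 2 × Fin n) (Fin 2 × Fin n) ℝ}
    {D : Matrix (Fin n) (Fin n) ℝ} (hA : M * Jn n * Mᵀ = J2 ⊗ₖ D) : |M.det| = |D.det| := by
  have h := congrArg Matrix.det hA
  simp only [Jn, det_mul, det_kronecker, det_J2, det_one, det_transpose, one_pow, one_mul,
    mul_one, Fintype.card_fin] at h
  exact (sq_eq_sq_iff_abs_eq_abs _ _).1 (by rw [← h, sq])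

/-- If the symplectic Gram matrix of `M` is `J₂ ⊗ diag(s²)` with `s` nowhere zero, then
`M = (I₂ ⊗ diag(s)) Rᵀ` for a symplectic matrix `R`. -/
theorem exists_symplectic_of_gram_eq {n : ℕ} {M : Matrix (Fin 2 × Fin n) (Fin 2 × Fin n) ℝ}
    {s : Fin n → ℝ} (hs : ∀ j, s j ≠ 0)
    (hA : M * Jn n * Mᵀ = J2 ⊗ₖ diagonal (fun j => s j * s j)) :
    ∃ R : Matrix (Fin 2 × Fin n) (Fin 2 × Fin n) ℝ, Rᵀ * Jn n * R = Jn n ∧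
      M = ((1 : Matrix (Fin 2) (Fin 2) ℝ) ⊗ₖ diagonal s) * Rᵀ := by
  let T : Matrix (Fin 2 × Fin n) (Fin 2 × Fin n) ℝ := 1 ⊗ₖ diagonal (fun j => (s j)⁻¹)
  have hT : Tᵀ = T := by
    simp [T, ← kroneckerMap_transpose]
  refine ⟨(T * M)ᵀ, ?_, ?_⟩
  · calc (T * M)ᵀᵀ * Jn n * (T * M)ᵀ = T * (M * Jn n * Mᵀ) * T := by
          simp only [transpose_transpose, transpose_mul, hT, Matrix.mul_assoc]
      _ = Jn n := by
          have hs' : (fun j => (s j)⁻¹ * (s j * s j) * (s j)⁻¹) = 1 := by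
            ext j
            simp [hs j]
          rw [hA, ← mul_kronecker_mul, ← mul_kronecker_mul, one_mul, mul_one,
            diagonal_mul_diagonal, diagonal_mul_diagonal, hs', Pi.one_def, diagonal_one, Jn]
  · rw [transpose_transpose, ← Matrix.mul_assoc, ← mul_kronecker_mul, diagonal_mul_diagonal]
    simp [hs]

/-- If the symplectic Gram matrix of an invertible `M` is in standard form
`J₂ ⊗ D` with `D` positive diagonal integer with non-increasing diagonal, and
`d = |det M|` is prime, then `D = diag(d, 1, …, 1)` and there is a symplectic `R` with
`M = (I₂ ⊗ diag(√d, 1, …, 1)) Rᵀ`. -/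
theorem stmt3 (n : ℕ) (hn : 1 ≤ n)
    (M : Matrix (Fin 2 × Fin n) (Fin 2 × Fin n) ℝ) (hM : IsUnit M.det)
    (D : Matrix (Fin n) (Fin n) ℝ)
    (hDdiag : D.IsDiag) (hDpos : ∀ j, 0 < D j j)
    (hDint : ∀ i j, ∃ z : ℤ, D i j = (z : ℝ))
    (hDmono : ∀ i j : Fin n, i ≤ j → D j j ≤ D i i)
    (hA : M * Jn n * Mᵀ = J2 ⊗ₖ D)
    (hprime : ∃ p : ℕ, p.Prime ∧ |M.det| = (p : ℝ)) :
    D = Matrix.diagonal (fun j : Fin n => if (j : ℕ) = 0 then |M.det| else 1) ∧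
    ∃ R : Matrix (Fin 2 × Fin n) (Fin 2 × Fin n) ℝ,
      Rᵀ * Jn n * R = Jn n ∧
      M = ((1 : Matrix (Fin 2) (Fin 2) ℝ) ⊗ₖ
            Matrix.diagonal (fun j : Fin n => if (j : ℕ) = 0 then Real.sqrt |M.det| else 1)) * Rᵀ := by
  obtain ⟨p, hp, hMp⟩ := hprime
  have hnat (j : Fin n) : ∃ m : ℕ, D j j = m := by
    obtain ⟨z, hz⟩ := hDint j j
    have hz_nonneg : 0 ≤ z := by exact_mod_cast hz ▸ (hDpos j).le
    lift z to ℕ using hz_nonneg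
    exact ⟨z, by simpa using hz⟩
  choose f hf using hnat
  have hD : D = diagonal (fun j => (f j : ℝ)) := by
    rw [← hDdiag.diagonal_diag]
    exact congrArg diagonal (funext hf)
  have hprod : ∏ j, f j = p := by
    have h := abs_det_eq_abs_det_of_gram_eq hA
    rw [hMp, hD, det_diagonal, ← Nat.cast_prod, Nat.abs_cast] at h
    exact_mod_cast h.symm
  have hanti : Antitone f := fun i j hij => by
    have h := hDmono i j hij
    rw [hf, hf] at h
    exact_mod_cast h
  have hDp : D = diagonal (fun j : Fin n => if (j : ℕ) = 0 then (p : ℝ) else 1) := by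
    rw [hD]
    congr! 2 with j
    rw [hp.eq_ite_of_antitone_of_prod_eq hanti hprod j]
    split_ifs <;> simp
  rw [hMp]
  refine ⟨hDp, exists_symplectic_of_gram_eq (fun j => ?_) ?_⟩
  · have := hp.pos
    split_ifs <;> positivity
  · rw [hA, hDp]
    congr! 3 with j
    split_ifs <;> simp
end

section
/- Let C_X, C_Z ⊆ 𝔽₂ⁿ and C'_X, C'_Z ⊆ 𝔽₂ⁿ be pairs of linear binary codes defining CSS qubit stabilizer codes, i.e. zᵀx = 0 in 𝔽₂ for all z ∈ C_Z, x ∈ C_X (and likewise for the primed pair). Let Q = C_Z × C_X ⊆ 𝔽₂^{2n} and Q' = C'_Z × C'_X be the symplectic binary representations of the stabilizer groups, and define the code distance d(Q) = min{wt(v) : v ∈ C_X^⊥ × C_Z^⊥, v ∉ Q}, where wt is the Hamming weight on 𝔽₂^{2n} and ⊥ denotes the binary Euclidean dual code. If Q and Q' have the same weight distribution, i.e. #{v ∈ Q : wt(v) = i} = #{v ∈ Q' : wt(v) = i} for every i = 0, …, 2n, then d(Q) = d(Q'). -/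
open Finset

/-- Hamming weight of a binary vector. -/
def wtv {n : ℕ} (v : Fin n → ZMod 2) : ℕ :=
  (Finset.univ.filter fun i => v i ≠ 0).card

/-- Hamming weight of an element of `𝔽₂^{2n}` written as a pair (Z-part, X-part). -/
def wtp {n : ℕ} (p : (Fin n → ZMod 2) × (Fin n → ZMod 2)) : ℕ :=
  wtv p.1 + wtv p.2

/-- The binary Euclidean dual code of a linear code `C ⊆ 𝔽₂ⁿ`. -/
def dualC {n : ℕ} (C : Submodule (ZMod 2) (Fin n → ZMod 2)) : Set (Fin n → ZMod 2) :=
  {y | ∀ c ∈ C, ∑ i, y i * c i = 0}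

/-- The sign character of `𝔽₂` with values in `ℤ[X]`. -/
noncomputable def signChar : AddChar (ZMod 2) (Polynomial ℤ) :=
  AddChar.zmodChar 2 neg_one_sq

lemma signChar_of_ne_zero {x : ZMod 2} (hx : x ≠ 0) : signChar x = -1 := by
  have hval : ∀ x : ZMod 2, x ≠ 0 → x.val = 1 := by decide
  rw [signChar, AddChar.zmodChar_apply, hval x hx, pow_one]

lemma signChar_sum {ι : Type*} (s : Finset ι) (f : ι → ZMod 2) :
    signChar (∑ i ∈ s, f i) = ∏ i ∈ s, signChar (f i) :=
  map_prod signChar.toMonoidHom (fun i => Multiplicative.ofAdd (f i)) s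

lemma wtv_le {n : ℕ} (v : Fin n → ZMod 2) : wtv v ≤ n := by
  simpa [wtv] using Finset.card_filter_le (Finset.univ : Finset (Fin n)) fun i => v i ≠ 0

open scoped Classical in
lemma sum_signChar {n : ℕ} (C : Submodule (ZMod 2) (Fin n → ZMod 2)) (u : Fin n → ZMod 2) :
    ∑ c with c ∈ C, signChar (∑ i, u i * c i) =
      if u ∈ dualC C then ((#{c | c ∈ C} : ℕ) : Polynomial ℤ) else 0 := by
  split_ifs with hu
  · rw [Finset.sum_congr rfl (g := fun _ => 1)]
    · simp
    · intro c hc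
      rw [hu c (by simpa using hc), AddChar.map_zero_eq_one]
  · obtain ⟨a, ha, hau⟩ : ∃ a ∈ C, ∑ i, u i * a i ≠ 0 := by
      simpa [dualC] using hu
    refine Finset.sum_involution (fun c _ => c + a) ?_ ?_ ?_ ?_
    · intro c _
      simp only [Pi.add_apply, mul_add, Finset.sum_add_distrib, AddChar.map_add_eq_mul,
        signChar_of_ne_zero hau]
      ring
    · rintro c - - h
      exact hau (by simp [add_eq_left.mp h])
    · intro c hc
      simpa using C.add_mem (by simpa using hc) ha
    · intro c _
      have h : a + a = 0 := funext fun i => CharTwo.add_self_eq_zero (a i)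
      simp [add_assoc, h]

lemma sum_signChar_mul_X_pow {n : ℕ} (c : Fin n → ZMod 2) :
    ∑ u : Fin n → ZMod 2, signChar (∑ i, u i * c i) * (Polynomial.X : Polynomial ℤ) ^ wtv u =
      (1 - Polynomial.X) ^ wtv c * (1 + Polynomial.X) ^ (n - wtv c) := by
  have hX (u : Fin n → ZMod 2) : (Polynomial.X : Polynomial ℤ) ^ wtv u =
      ∏ i, if u i ≠ 0 then Polynomial.X else 1 := by
    simp [wtv, Finset.prod_ite]
  have hcard : #{i | ¬ c i ≠ 0} = n - wtv c := by
    have := Finset.card_filter_add_card_filter_not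
      (s := (Finset.univ : Finset (Fin n))) fun i => c i ≠ 0
    rw [Finset.card_univ, Fintype.card_fin] at this
    unfold wtv
    omega
  calc _ = ∑ u : Fin n → ZMod 2, ∏ i, (signChar (u i * c i) *
        if u i ≠ 0 then (Polynomial.X : Polynomial ℤ) else 1) := by
        refine Finset.sum_congr rfl fun u _ => ?_
        rw [hX, signChar_sum, Finset.prod_mul_distrib]
    _ = ∏ i, ∑ t : ZMod 2, (signChar (t * c i) *
        if t ≠ 0 then (Polynomial.X : Polynomial ℤ) else 1) :=
        (Fintype.prod_sum fun i (t : ZMod 2) => signChar (t * c i) *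
          if t ≠ 0 then (Polynomial.X : Polynomial ℤ) else 1).symm
    _ = ∏ i, if c i ≠ 0 then (1 - Polynomial.X : Polynomial ℤ) else 1 + Polynomial.X := by
        refine Finset.prod_congr rfl fun i _ => ?_
        have huniv : (Finset.univ : Finset (ZMod 2)) = {0, 1} := by decide
        rw [huniv, Finset.sum_pair (by decide)]
        split_ifs with h1 h2 h3 <;> simp_all [signChar_of_ne_zero, sub_eq_add_neg]
    _ = _ := by
        rw [Finset.prod_ite, Finset.prod_const, Finset.prod_const, hcard]
        rfl

open scoped Classical in
/-- The MacWilliams identity for binary linear codes. -/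
lemma macWilliams {n : ℕ} (C : Submodule (ZMod 2) (Fin n → ZMod 2)) :
    ((#{c | c ∈ C} : ℕ) : Polynomial ℤ) * ∑ u with u ∈ dualC C, Polynomial.X ^ wtv u =
      ∑ c with c ∈ C, (1 - Polynomial.X) ^ wtv c * (1 + Polynomial.X) ^ (n - wtv c) := by
  simp_rw [← sum_signChar_mul_X_pow]
  rw [Finset.sum_comm]
  simp_rw [← Finset.sum_mul, sum_signChar]
  rw [Finset.mul_sum, Finset.sum_filter]
  exact Finset.sum_congr rfl fun u _ => by split_ifs <;> simp

open scoped Classical in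
/-- The MacWilliams identity for the product code `D × C ⊆ 𝔽₂^{2n}`. -/
lemma macWilliams_prod {n : ℕ} (C D : Submodule (ZMod 2) (Fin n → ZMod 2)) :
    ((#{p : (Fin n → ZMod 2) × (Fin n → ZMod 2) | p.1 ∈ D ∧ p.2 ∈ C} : ℕ) : Polynomial ℤ) *
        ∑ p : (Fin n → ZMod 2) × (Fin n → ZMod 2) with p.1 ∈ dualC C ∧ p.2 ∈ dualC D,
          Polynomial.X ^ wtp p =
      ∑ p : (Fin n → ZMod 2) × (Fin n → ZMod 2) with p.1 ∈ D ∧ p.2 ∈ C,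
        (1 - Polynomial.X) ^ wtp p * (1 + Polynomial.X) ^ (2 * n - wtp p) := by
  have hprod (P R : (Fin n → ZMod 2) → Prop) :
      ({p : (Fin n → ZMod 2) × (Fin n → ZMod 2) | P p.1 ∧ R p.2} : Finset _) =
        ({u | P u} : Finset _) ×ˢ ({u | R u} : Finset _) := by
    ext; simp
  rw [hprod (· ∈ D) (· ∈ C), hprod (· ∈ dualC C) (· ∈ dualC D), Finset.card_product,
    Nat.cast_mul]
  have hexp (p : (Fin n → ZMod 2) × (Fin n → ZMod 2)) :
      2 * n - wtp p = (n - wtv p.1) + (n - wtv p.2) := by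
    have h₁ := wtv_le p.1
    have h₂ := wtv_le p.2
    unfold wtp
    omega
  simp_rw [hexp, wtp, pow_add, mul_mul_mul_comm]
  rw [Finset.sum_product, Finset.sum_product]
  simp only
  rw [← Finset.sum_mul_sum, ← Finset.sum_mul_sum, ← macWilliams, ← macWilliams]
  ring

open scoped Classical in
lemma sum_comp_eq_of_card_fiber_eq {α M : Type*} [AddCommMonoid M] {S T : Finset α} {w : α → ℕ}
    (h : ∀ k, #{p ∈ S | w p = k} = #{p ∈ T | w p = k}) (f : ℕ → M) :
    ∑ p ∈ S, f (w p) = ∑ p ∈ T, f (w p) := by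
  have hmap : S.val.map w = T.val.map w := by
    ext k
    rw [Multiset.count_map, Multiset.count_map]
    simp only [eq_comm (a := k)]
    exact h k
  have hsum := congrArg (fun m => (m.map f).sum) hmap
  simp only [Multiset.map_map] at hsum
  exact hsum

open scoped Classical in
lemma card_dual_eq {n : ℕ} {C D C' D' : Submodule (ZMod 2) (Fin n → ZMod 2)}
    (h : ∀ k, #{p : (Fin n → ZMod 2) × (Fin n → ZMod 2) | (p.1 ∈ D ∧ p.2 ∈ C) ∧ wtp p = k} =
      #{p : (Fin n → ZMod 2) × (Fin n → ZMod 2) | (p.1 ∈ D' ∧ p.2 ∈ C') ∧ wtp p = k}) (k : ℕ) :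
    #{p : (Fin n → ZMod 2) × (Fin n → ZMod 2) |
        (p.1 ∈ dualC C ∧ p.2 ∈ dualC D) ∧ wtp p = k} =
      #{p : (Fin n → ZMod 2) × (Fin n → ZMod 2) |
        (p.1 ∈ dualC C' ∧ p.2 ∈ dualC D') ∧ wtp p = k} := by
  simp only [← Finset.filter_filter _ fun p => wtp p = _] at h ⊢
  have hcard := sum_comp_eq_of_card_fiber_eq h fun _ => 1
  simp only [← Finset.card_eq_sum_ones] at hcard
  have hsum := sum_comp_eq_of_card_fiber_eq h fun j =>
    ((1 - Polynomial.X) ^ j * (1 + Polynomial.X) ^ (2 * n - j) : Polynomial ℤ)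
  rw [← macWilliams_prod, ← macWilliams_prod, hcard] at hsum
  have hne : ((#{p : (Fin n → ZMod 2) × (Fin n → ZMod 2) | p.1 ∈ D' ∧ p.2 ∈ C'} : ℕ) :
      Polynomial ℤ) ≠ 0 := by
    rw [Nat.cast_ne_zero, Finset.card_ne_zero]
    exact ⟨0, by simp⟩
  have hcoeff := congrArg (Polynomial.coeff · k) (mul_left_cancel₀ hne hsum)
  simpa [Polynomial.finsetSum_coeff, Polynomial.coeff_X_pow, Finset.sum_boole, eq_comm]
    using hcoeff

open scoped Classical in
lemma card_dual_eq_add {n : ℕ} {C D : Submodule (ZMod 2) (Fin n → ZMod 2)}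
    (h : ∀ z ∈ D, ∀ x ∈ C, ∑ i, z i * x i = 0) (k : ℕ) :
    #{p : (Fin n → ZMod 2) × (Fin n → ZMod 2) |
        (p.1 ∈ dualC C ∧ p.2 ∈ dualC D) ∧ wtp p = k} =
      #{p : (Fin n → ZMod 2) × (Fin n → ZMod 2) | (p.1 ∈ D ∧ p.2 ∈ C) ∧ wtp p = k} +
      #{p : (Fin n → ZMod 2) × (Fin n → ZMod 2) |
        p.1 ∈ dualC C ∧ p.2 ∈ dualC D ∧ ¬(p.1 ∈ D ∧ p.2 ∈ C) ∧ k = wtp p} := by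
  have hsub (p : (Fin n → ZMod 2) × (Fin n → ZMod 2)) (hp : p.1 ∈ D ∧ p.2 ∈ C) :
      p.1 ∈ dualC C ∧ p.2 ∈ dualC D :=
    ⟨h p.1 hp.1, fun z hz => by simpa only [mul_comm] using h z hz p.2 hp.2⟩
  rw [← Finset.card_filter_add_card_filter_not fun p => p.1 ∈ D ∧ p.2 ∈ C,
    Finset.filter_filter, Finset.filter_filter]
  congr 2 <;> ext p <;> have := hsub p <;> simp only [Finset.mem_filter] <;> grind

/-- Two CSS qubit stabilizer codes (given by pairs of orthogonal binary
linear codes) whose stabilizer groups `Q = C_Z × C_X` have the same weight distribution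
have the same code distance `d(Q) = min{wt v : v ∈ C_X^⊥ × C_Z^⊥, v ∉ Q}`. -/
theorem stmt9 (n : ℕ) (hn : 1 ≤ n)
    (CX CZ CX' CZ' : Submodule (ZMod 2) (Fin n → ZMod 2))
    (hCSS : ∀ z ∈ CZ, ∀ x ∈ CX, ∑ i, z i * x i = 0)
    (hCSS' : ∀ z ∈ CZ', ∀ x ∈ CX', ∑ i, z i * x i = 0)
    (hw : ∀ k : ℕ,
      ({p : (Fin n → ZMod 2) × (Fin n → ZMod 2) |
          (p.1 ∈ CZ ∧ p.2 ∈ CX) ∧ wtp p = k}).ncard =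
      ({p : (Fin n → ZMod 2) × (Fin n → ZMod 2) |
          (p.1 ∈ CZ' ∧ p.2 ∈ CX') ∧ wtp p = k}).ncard)
    (d d' : ℕ)
    (hd : IsLeast {k : ℕ | ∃ p : (Fin n → ZMod 2) × (Fin n → ZMod 2),
        p.1 ∈ dualC CX ∧ p.2 ∈ dualC CZ ∧ ¬(p.1 ∈ CZ ∧ p.2 ∈ CX) ∧ k = wtp p} d)
    (hd' : IsLeast {k : ℕ | ∃ p : (Fin n → ZMod 2) × (Fin n → ZMod 2),
        p.1 ∈ dualC CX' ∧ p.2 ∈ dualC CZ' ∧ ¬(p.1 ∈ CZ' ∧ p.2 ∈ CX') ∧ k = wtp p} d') :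
    d = d' := by
  classical
  simp only [← Finset.coe_filter_univ, Set.ncard_coe_finset] at hw
  have hset (k : ℕ) := card_dual_eq hw k
  simp only [card_dual_eq_add hCSS, card_dual_eq_add hCSS', hw, add_right_inj] at hset
  have heq : {k | ∃ p : (Fin n → ZMod 2) × (Fin n → ZMod 2),
        p.1 ∈ dualC CX ∧ p.2 ∈ dualC CZ ∧ ¬(p.1 ∈ CZ ∧ p.2 ∈ CX) ∧ k = wtp p} =
      {k | ∃ p : (Fin n → ZMod 2) × (Fin n → ZMod 2),
        p.1 ∈ dualC CX' ∧ p.2 ∈ dualC CZ' ∧ ¬(p.1 ∈ CZ' ∧ p.2 ∈ CX') ∧ k = wtp p} := by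
    ext k
    have h := congrArg (0 < ·) (hset k)
    simp only [Finset.card_pos, Finset.Nonempty, Finset.mem_filter, Finset.mem_univ,
      true_and] at h
    exact h.to_iff
  exact hd.unique (heq ▸ hd')
end

section
/- Let m ≥ 1 and let Q be a finite nonempty set of vectors in {0,1}^m ⊂ ℝ^m (the codewords of a binary code, embedded as 0/1 integer vectors). Let Λ(Q) = {(c + 2a)/√2 : c ∈ Q, a ∈ ℤ^m} ⊂ ℝ^m be the Construction A lattice packing associated to Q. Then for every complex z with Im(z) > 0, the theta function of Λ(Q) satisfies Θ_{Λ(Q)}(z) := Σ_{x ∈ Λ(Q)} e^{iπz‖x‖²} = Σ_{c ∈ Q} θ₃(2z)^{m − wt(c)} · θ₂(2z)^{wt(c)} = W_Q(θ₃(2z), θ₂(2z)), where wt(c) is the Hamming weight of c, θ₃(z) = Σ_{k∈ℤ} e^{iπz k²} and θ₂(z) = Σ_{k∈ℤ} e^{iπz (k+1/2)²}, and all series converge absolutely. -/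
open Complex Finset

/-- Hamming weight of a real 0/1 vector: number of nonzero coordinates. -/
noncomputable def wt {m : ℕ} (c : Fin m → ℝ) : ℕ :=
  (Finset.univ.filter fun i => c i ≠ 0).card

/-- The Construction A lattice packing `Λ(Q) = {(c + 2a)/√2 : c ∈ Q, a ∈ ℤ^m}`. -/
def constrA {m : ℕ} (Q : Finset (Fin m → ℝ)) : Set (Fin m → ℝ) :=
  {x | ∃ c ∈ Q, ∃ a : Fin m → ℤ, x = fun i => (c i + 2 * (a i : ℝ)) / Real.sqrt 2}

/-- The theta constant `θ₃(z) = Σ_{k∈ℤ} e^{iπz k²}`. -/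
noncomputable def theta3 (z : ℂ) : ℂ :=
  ∑' k : ℤ, Complex.exp (Real.pi * Complex.I * z * (k : ℂ) ^ 2)

/-- The theta constant `θ₂(z) = Σ_{k∈ℤ} e^{iπz (k+1/2)²}`. -/
noncomputable def theta2 (z : ℂ) : ℂ :=
  ∑' k : ℤ, Complex.exp (Real.pi * Complex.I * z * ((k : ℂ) + 1/2) ^ 2)

theorem summable_norm_and_hasSum_fin_prod {β R : Type*} [NormedCommRing R] [NormOneClass R]
    [CompleteSpace R] {n : ℕ} (f : Fin n → β → R) (hf : ∀ i, Summable fun b => ‖f i b‖) :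
    (Summable fun a : Fin n → β => ‖∏ i, f i (a i)‖) ∧
      HasSum (fun a : Fin n → β => ∏ i, f i (a i)) (∏ i, ∑' b, f i b) := by
  induction n with
  | zero => exact ⟨Summable.of_finite, by simp⟩
  | succ n ih =>
    obtain ⟨hs, hh⟩ := ih (fun i => f i.succ) fun i => hf i.succ
    have hs' := (hf 0).mul_norm hs
    have hh' := (hf 0).of_norm.hasSum.mul hh hs'.of_norm
    rw [← (Fin.consEquiv fun _ : Fin (n + 1) => β).summable_iff,
      ← (Fin.consEquiv fun _ : Fin (n + 1) => β).hasSum_iff]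
    simpa [Function.comp_def, Fin.prod_univ_succ, Fin.consEquiv] using And.intro hs' hh'

theorem summable_exp_mul_sq {τ : ℂ} (hτ : 0 < τ.im) :
    Summable fun k : ℤ => cexp (Real.pi * I * τ * (k : ℂ) ^ 2) := by
  refine ((summable_jacobiTheta₂_term_iff 0 τ).2 hτ).congr fun k => ?_
  rw [jacobiTheta₂_term]
  ring_nf

theorem summable_exp_mul_add_half_sq {τ : ℂ} (hτ : 0 < τ.im) :
    Summable fun k : ℤ => cexp (Real.pi * I * τ * ((k : ℂ) + 1 / 2) ^ 2) := by
  refine (((summable_jacobiTheta₂_term_iff (τ / 2) τ).2 hτ).mul_left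
    (cexp (Real.pi * I * τ / 4))).congr fun k => ?_
  rw [jacobiTheta₂_term, ← Complex.exp_add]
  ring_nf

/-- The parametrization `(c, a) ↦ (c + 2a)/√2` of the Construction A packing of a binary code. -/
noncomputable def constrAEquiv {m : ℕ} (Q : Finset (Fin m → ℝ))
    (hQ : ∀ c ∈ Q, ∀ i, c i = 0 ∨ c i = 1) : Q × (Fin m → ℤ) ≃ constrA Q :=
  Equiv.ofBijective
    (fun p => ⟨fun i => ((p.1 : Fin m → ℝ) i + 2 * (p.2 i : ℝ)) / Real.sqrt 2,
      p.1, p.1.2, p.2, rfl⟩) <| by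
    constructor
    · rintro ⟨⟨c, hc⟩, a⟩ ⟨⟨d, hd⟩, b⟩ h
      have hi (i : Fin m) : c i = d i ∧ a i = b i := by
        have hi : c i + 2 * (a i : ℝ) = d i + 2 * (b i : ℝ) := by
          simpa [div_left_inj'] using congrFun (Subtype.ext_iff.1 h) i
        rcases hQ c hc i with h1 | h1 <;> rcases hQ d hd i with h2 | h2 <;>
          rw [h1, h2] at hi ⊢ <;> norm_cast at hi ⊢ <;> omega
      simp only [Prod.mk.injEq, Subtype.mk.injEq]
      exact ⟨funext fun i => (hi i).1, funext fun i => (hi i).2⟩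
    · rintro ⟨_, c, hc, a, rfl⟩
      exact ⟨(⟨c, hc⟩, a), rfl⟩

theorem exp_constrAEquiv {m : ℕ} (Q : Finset (Fin m → ℝ))
    (hQ : ∀ c ∈ Q, ∀ i, c i = 0 ∨ c i = 1) (z : ℂ) (p : Q × (Fin m → ℤ)) :
    cexp (Real.pi * I * z * ((∑ i, (constrAEquiv Q hQ p : Fin m → ℝ) i ^ 2 : ℝ) : ℂ)) =
      ∏ i, cexp (Real.pi * I * (2 * z) *
        ((p.2 i : ℂ) + (((p.1 : Fin m → ℝ) i : ℝ) : ℂ) / 2) ^ 2) := by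
  rw [← Complex.exp_sum, Complex.ofReal_sum, Finset.mul_sum]
  congr 1
  refine Finset.sum_congr rfl fun i _ => ?_
  have h : (constrAEquiv Q hQ p : Fin m → ℝ) i ^ 2 =
      2 * ((p.2 i : ℝ) + (p.1 : Fin m → ℝ) i / 2) ^ 2 := by
    change (((p.1 : Fin m → ℝ) i + 2 * (p.2 i : ℝ)) / Real.sqrt 2) ^ 2 = _
    rw [div_pow, Real.sq_sqrt zero_le_two]
    ring
  rw [h]
  push_cast
  ring

theorem prod_theta_eq_pow_wt {m : ℕ} {c : Fin m → ℝ} (hc : ∀ i, c i = 0 ∨ c i = 1) (τ : ℂ) :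
    ∏ i, ∑' k : ℤ, cexp (Real.pi * I * τ * ((k : ℂ) + ((c i : ℝ) : ℂ) / 2) ^ 2) =
      theta3 τ ^ (m - wt c) * theta2 τ ^ wt c := by
  have h (i : Fin m) : ∑' k : ℤ, cexp (Real.pi * I * τ * ((k : ℂ) + ((c i : ℝ) : ℂ) / 2) ^ 2) =
      if c i ≠ 0 then theta2 τ else theta3 τ := by
    rcases hc i with h | h <;> simp [h, theta2, theta3]
  have hcard : (univ.filter fun i => ¬ c i ≠ 0).card = m - wt c := by
    have := card_filter_add_card_filter_not (s := univ) fun i => c i ≠ 0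
    rw [card_univ, Fintype.card_fin] at this
    rw [wt]
    omega
  rw [Finset.prod_congr rfl fun i _ => h i, Finset.prod_ite, prod_const, prod_const, hcard, wt,
    mul_comm]

/-- For a nonempty binary code `Q ⊆ {0,1}^m` (embedded in `ℝ^m`) and
`Im z > 0`, the theta function of the Construction A packing `Λ(Q)` equals the weight
enumerator of `Q` evaluated at the theta constants:
`Θ_{Λ(Q)}(z) = Σ_{c∈Q} θ₃(2z)^{m−wt(c)} θ₂(2z)^{wt(c)}`, all series converging
absolutely. -/
theorem stmt17 (m : ℕ) (hm : 1 ≤ m)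
    (Q : Finset (Fin m → ℝ)) (hQne : Q.Nonempty)
    (hQ01 : ∀ c ∈ Q, ∀ i, c i = 0 ∨ c i = 1)
    (z : ℂ) (hz : 0 < z.im) :
    Summable (fun x : (constrA Q) =>
      Complex.exp (Real.pi * Complex.I * z * ((∑ i, (x : Fin m → ℝ) i ^ 2 : ℝ) : ℂ))) ∧
    Summable (fun k : ℤ => Complex.exp (Real.pi * Complex.I * (2*z) * (k : ℂ) ^ 2)) ∧
    Summable (fun k : ℤ => Complex.exp (Real.pi * Complex.I * (2*z) * ((k : ℂ) + 1/2) ^ 2)) ∧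
    (∑' x : (constrA Q),
        Complex.exp (Real.pi * Complex.I * z * ((∑ i, (x : Fin m → ℝ) i ^ 2 : ℝ) : ℂ)))
      = ∑ c ∈ Q, theta3 (2*z) ^ (m - wt c) * theta2 (2*z) ^ (wt c) := by
  have hτ : 0 < (2 * z).im := by simpa using hz
  have h3 := summable_exp_mul_sq hτ
  have h2 := summable_exp_mul_add_half_sq hτ
  have hterm (c : Q) (i : Fin m) : Summable fun k : ℤ =>
      ‖cexp (Real.pi * I * (2 * z) * ((k : ℂ) + (((c : Fin m → ℝ) i : ℝ) : ℂ) / 2) ^ 2)‖ := by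
    rcases hQ01 c c.2 i with h | h
    · simpa [h] using h3.norm
    · simpa [h] using h2.norm
  have hprod (c : Q) := summable_norm_and_hasSum_fin_prod _ (hterm c)
  have hsum : Summable fun p : Q × (Fin m → ℤ) => ∏ i, cexp (Real.pi * I * (2 * z) *
      ((p.2 i : ℂ) + (((p.1 : Fin m → ℝ) i : ℝ) : ℂ) / 2) ^ 2) :=
    .of_norm <| (summable_prod_of_nonneg fun _ => norm_nonneg _).2
      ⟨fun c => (hprod c).1, .of_finite⟩
  refine ⟨?_, h3, h2, ?_⟩
  · rw [← (constrAEquiv Q hQ01).summable_iff]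
    exact hsum.congr fun p => (exp_constrAEquiv Q hQ01 z p).symm
  · rw [← (constrAEquiv Q hQ01).tsum_eq, tsum_congr (exp_constrAEquiv Q hQ01 z),
      hsum.tsum_prod, tsum_fintype, ← Finset.sum_coe_sort Q]
    exact Finset.sum_congr rfl fun c _ =>
      (hprod c).2.tsum_eq.trans (prod_theta_eq_pow_wt (hQ01 c c.2) _)
end
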